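/- arXiv:1803.01131 — 3 statements merged into one kernel-verified Lean document; each statement's English description precedes it below -/
import Mathlib

section
/- Let M be a free ℤ-module and let K, L, H ∈ M with K ≠ 0. Let r, m, ι be positive integers with gcd(r, m) = 1 such that r • K + m • L = 0, ι • H = −K, and ι is the greatest positive integer dividing −K, i.e. for every positive integer d and every H' ∈ M, if d • H' = −K then d ≤ ι. Then m divides ι, and writing ι = k·m with k a positive integer, one has L = (k·r) • H. -/
theorem bez_aux {M : Type*} [AddCommGroup M] (p q : ℕ) (hpq : Nat.Coprime p q) (x y : M)
    (h : p • x = q • y) : ∃ z : M, y = p • z := by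
  have hb := Nat.gcd_eq_gcd_ab p q
  rw [hpq] at hb
  generalize Nat.gcdA p q = a at hb
  generalize Nat.gcdB p q = b at hb
  refine ⟨a • y + b • x, ?_⟩
  have e : y = (1 : ℤ) • y := by simp
  have hc : (p : ℤ) • x = (q : ℤ) • y := by
    simpa only [natCast_zsmul] using h
  rw [← natCast_zsmul]
  calc y = ((1 : ℕ) : ℤ) • y := by simp
    _ = (p : ℤ) • (a • y) + b • ((q : ℤ) • y) := by rw [hb]; module
    _ = _ := by rw [← hc]; module

/-- Arithmetic core of Lemma 2.4: in a free `ℤ`-module `M`, if `K ≠ 0`,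
`r • K + m • L = 0` with `gcd(r, m) = 1`, `ι • H = -K` and `ι` is the greatest
positive integer dividing `-K`, then `m ∣ ι` and, writing `ι = k * m`,
one has `L = (k * r) • H`. -/
theorem stmt_1 {M : Type*} [AddCommGroup M] [Module ℤ M] [Module.Free ℤ M]
    (K L H : M) (hK : K ≠ 0) (r m ι : ℕ) (hr : 0 < r) (hm : 0 < m) (hι : 0 < ι)
    (hcop : Nat.Coprime r m)
    (h1 : r • K + m • L = 0)
    (h2 : ι • H = -K)
    (hmax : ∀ d : ℕ, 0 < d → ∀ H' : M, d • H' = -K → d ≤ ι) :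
    ∃ k : ℕ, 0 < k ∧ ι = k * m ∧ L = (k * r) • H := by
  have inj : ∀ n : ℕ, 0 < n → ∀ x y : M, n • x = n • y → x = y := by
    intro n hn x y h
    have b := Module.Free.chooseBasis ℤ M
    apply b.repr.injective
    ext i
    have h' := congrArg (fun z => b.repr z i) h
    simp only [map_nsmul, Finsupp.smul_apply, nsmul_eq_mul] at h'
    exact mul_left_cancel₀ (by exact_mod_cast hn.ne') h'
  have hL : m • L = r • (-K) := by
    rw [smul_neg]; exact eq_neg_of_add_eq_zero_right h1
  obtain ⟨P, hP⟩ := bez_aux m r hcop.symm L (-K) hL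
  obtain ⟨g, m', i', hg, hco, hm', hi'⟩ := Nat.exists_coprime' (m := m) (n := ι)
    (Nat.gcd_pos_of_pos_left _ hm)
  have hgP : m' • P = i' • H := by
    apply inj g hg
    rw [← mul_smul, ← mul_smul, mul_comm g, mul_comm g, ← hm', ← hi', h2, hP]
  obtain ⟨z, hz⟩ := bez_aux m' i' hco P H hgP
  have hm0 : 0 < m' := by
    rcases Nat.eq_zero_or_pos m' with h | h
    · subst h; omega
    · exact h
  have hle := hmax (ι * m') (Nat.mul_pos hι hm0) z (by rw [mul_smul, ← hz, h2])
  have hone : m' = 1 := by nlinarith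
  have hi0 : 0 < i' := by
    rcases Nat.eq_zero_or_pos i' with h | h
    · subst h; omega
    · exact h
  have hmg : m = g := by rw [hm', hone, one_mul]
  refine ⟨i', hi0, by rw [hmg, hi'], ?_⟩
  apply inj m hm
  rw [hL, ← h2, ← mul_smul, ← mul_smul]
  congr 1
  rw [hi', hmg]; ring
end

section
/- Let n ≥ 3 be an integer and a₁₁, a₁₂, a₂₂ ∈ ℚ. Define rationals m₀, m₁, …, m_n by the polynomial identity in ℚ[X]: n!·(a₁₁·X² + 2a₁₂·X + a₂₂)·((n−1)·X − 1)^{n−2} = Σ_{j=0}^{n} C(n, j)·m_j·X^j, i.e. m_j := n!/C(n,j) times the coefficient of X^j of the left-hand side. Then m₃ + 3(n−1)·m₂ + 3(n−1)²·m₁ + (n−1)³·m₀ = 0. -/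
open Polynomial

theorem coeffs_aux (c : ℚ) (k : ℕ) :
    ((C c * X - 1 : ℚ[X]) ^ k).coeff 0 = (-1) ^ k ∧
    ((C c * X - 1 : ℚ[X]) ^ k).coeff 1 = -(-1) ^ k * k * c ∧
    ((C c * X - 1 : ℚ[X]) ^ k).coeff 2 = (-1) ^ k * (k * (k - 1) / 2) * c ^ 2 ∧
    ((C c * X - 1 : ℚ[X]) ^ k).coeff 3 = -(-1) ^ k * (k * (k - 1) * (k - 2) / 6) * c ^ 3 := by
  induction k with
  | zero => simp [coeff_one]
  | succ k ih =>
    obtain ⟨h0, h1, h2, h3⟩ := ih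
    have e : (C c * X - 1 : ℚ[X]) ^ (k + 1)
        = C c * ((C c * X - 1 : ℚ[X]) ^ k * X) - (C c * X - 1 : ℚ[X]) ^ k := by ring
    rw [e]
    simp only [coeff_sub, coeff_C_mul, coeff_mul_X_zero, coeff_mul_X, h0, h1, h2, h3]
    refine ⟨?_, ?_, ?_, ?_⟩ <;> push_cast <;> ring

theorem choose_three_aux (j : ℕ) :
    ((Nat.choose (j + 3) 3 : ℕ) : ℚ) = (j + 1) * (j + 2) * (j + 3) / 6 := by
  induction j with
  | zero => norm_num
  | succ j ih =>
    rw [show j + 1 + 3 = (j + 3) + 1 by ring, Nat.choose_succ_succ' (j + 3) 2]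
    push_cast
    rw [ih, Nat.cast_choose_two]
    push_cast
    ring

/-- The computation in the proof of Theorem 4.3: with
`m_j := (n!/C(n,j)) ·` (coefficient of `X^j` in
`(a₁₁X² + 2a₁₂X + a₂₂)((n-1)X - 1)^{n-2}`), so that
`n!(a₁₁X² + 2a₁₂X + a₂₂)((n-1)X - 1)^{n-2} = Σ_j C(n,j) m_j X^j`,
one has `m₃ + 3(n-1)m₂ + 3(n-1)²m₁ + (n-1)³m₀ = 0`. -/
theorem stmt_11 (n : ℕ) (hn : 3 ≤ n) (a₁₁ a₁₂ a₂₂ : ℚ) (m : ℕ → ℚ)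
    (hm : ∀ j : ℕ, m j =
      (Nat.factorial n : ℚ) / (Nat.choose n j : ℚ) *
        ((C a₁₁ * X ^ 2 + C (2 * a₁₂) * X + C a₂₂) *
          (C ((n : ℚ) - 1) * X - 1) ^ (n - 2)).coeff j) :
    m 3 + 3 * ((n : ℚ) - 1) * m 2 + 3 * ((n : ℚ) - 1) ^ 2 * m 1 +
      ((n : ℚ) - 1) ^ 3 * m 0 = 0 := by
  obtain ⟨j, rfl⟩ : ∃ j, n = j + 3 := ⟨n - 3, by omega⟩
  obtain ⟨h0, h1, h2, h3⟩ := coeffs_aux (((j + 3 : ℕ) : ℚ) - 1) (j + 1)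
  rw [show j + 3 - 2 = j + 1 by omega] at hm
  generalize hP : (C (((j + 3 : ℕ) : ℚ) - 1) * X - 1 : ℚ[X]) ^ (j + 1) = P at *
  have e : (C a₁₁ * X ^ 2 + C (2 * a₁₂) * X + C a₂₂) * P
      = C a₁₁ * (P * X * X) + C (2 * a₁₂) * (P * X) + C a₂₂ * P := by ring
  rw [e] at hm
  rw [hm 0, hm 1, hm 2, hm 3, choose_three_aux, Nat.cast_choose_two]
  simp only [coeff_add, coeff_C_mul, coeff_mul_X_zero, coeff_mul_X, h0, h1, h2, h3,
    Nat.choose_zero_right, Nat.choose_one_right]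
  push_cast
  have p1 : (j : ℚ) + 1 ≠ 0 := by positivity
  have p2 : (j : ℚ) + 2 ≠ 0 := by positivity
  have p3 : (j : ℚ) + 3 ≠ 0 := by positivity
  rw [show (j : ℚ) + 3 - 1 = j + 2 by ring]
  field_simp
  ring
end

section
/- Let n ≥ 3 be an integer, s ≥ 1 an integer, and χ₀, χ, k, h ∈ ℚ. Set q := 1 + (s/2)(k + s·h), d := s(h − k), a₀₀ := χ₀/(n−2)!, a₁₁ := ((n−1)/(2·n!))·(−2χ₀(n−1)² + 2χ(n−1) + (n+1)k − h), a₁₂ := (1/(2·n!))·(2χ₀(n−1)² − 2χ(n−1) − k + h), a₂₂ := (1/(2·n!))·(−2χ₀(n−1) + 2χ − k + h), and R(x, y) := a₁₁x² + 2a₁₂xy + a₂₂y² − a₁₁x − a₁₂y + a₀₀. Then for all x, y ∈ ℚ: R((1+s)x, y + s(n−1)x) − R((1+s)x − s, y + s(n−1)x − s(n−1)) = (2q−2)/(n−2)!·x + d/(n−1)!·y − (q−1)/(n−2)!. -/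
/-- The identity of Example 4.2 computing the Hilbert curve of a scroll over a
smooth surface: the increment of the quadratic factor `R` under the substitution
equals the linear factor of the Hilbert-curve polynomial of the induced scroll
over a curve in `|sA|`. -/
theorem stmt_15 (n : ℕ) (hn : 3 ≤ n) (s : ℕ) (hs : 1 ≤ s) (χ₀ χ k h : ℚ)
    (q d a₀₀ a₁₁ a₁₂ a₂₂ : ℚ)
    (hq : q = 1 + ((s : ℚ) / 2) * (k + (s : ℚ) * h))
    (hd : d = (s : ℚ) * (h - k))
    (ha00 : a₀₀ = χ₀ / (Nat.factorial (n - 2) : ℚ))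
    (ha11 : a₁₁ = (((n : ℚ) - 1) / (2 * (Nat.factorial n : ℚ))) *
      (-2 * χ₀ * ((n : ℚ) - 1) ^ 2 + 2 * χ * ((n : ℚ) - 1) + ((n : ℚ) + 1) * k - h))
    (ha12 : a₁₂ = (1 / (2 * (Nat.factorial n : ℚ))) *
      (2 * χ₀ * ((n : ℚ) - 1) ^ 2 - 2 * χ * ((n : ℚ) - 1) - k + h))
    (ha22 : a₂₂ = (1 / (2 * (Nat.factorial n : ℚ))) *
      (-2 * χ₀ * ((n : ℚ) - 1) + 2 * χ - k + h))
    (R : ℚ → ℚ → ℚ)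
    (hR : ∀ x y : ℚ, R x y =
      a₁₁ * x ^ 2 + 2 * a₁₂ * x * y + a₂₂ * y ^ 2 - a₁₁ * x - a₁₂ * y + a₀₀) :
    ∀ x y : ℚ,
      R ((1 + (s : ℚ)) * x) (y + (s : ℚ) * ((n : ℚ) - 1) * x) -
        R ((1 + (s : ℚ)) * x - (s : ℚ))
          (y + (s : ℚ) * ((n : ℚ) - 1) * x - (s : ℚ) * ((n : ℚ) - 1)) =
      (2 * q - 2) / (Nat.factorial (n - 2) : ℚ) * x +
        d / (Nat.factorial (n - 1) : ℚ) * y -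
        (q - 1) / (Nat.factorial (n - 2) : ℚ) := by
  intro x y
  obtain ⟨m, rfl⟩ : ∃ m, n = m + 2 := ⟨n - 2, by omega⟩
  have e1 : m + 2 - 2 = m := by omega
  have e2 : m + 2 - 1 = m + 1 := by omega
  have hf : (Nat.factorial m : ℚ) ≠ 0 := by exact_mod_cast Nat.factorial_ne_zero m
  have h1 : (m : ℚ) + 1 ≠ 0 := by positivity
  have h2 : (m : ℚ) + 2 ≠ 0 := by positivity
  have f1 : (Nat.factorial (m + 1) : ℚ) = (m + 1) * Nat.factorial m := by
    rw [Nat.factorial_succ]; push_cast; ring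
  have f2 : (Nat.factorial (m + 2) : ℚ) = (m + 2) * ((m + 1) * Nat.factorial m) := by
    rw [Nat.factorial_succ, Nat.cast_mul, f1]; push_cast; ring
  rw [e1] at ha00
  rw [e1, e2, hR, hR, hq, hd, ha00, ha11, ha12, ha22, f1, f2]
  push_cast
  field_simp
  ring
end
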